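/- Let m, q∞ > 0 and ϑ₀ ∈ (0, π/2). The functions ϑ(t) = (1/2)·arccot(cot(2ϑ₀) + m t/(4q∞²)), p*(t) = q∞/sin ϑ(t), q*(t) = q∞/cos ϑ(t) satisfy, for all t ≥ 0: ṗ*(t) = F(q*(t), p*(t)) and q̇*(t) = −F(p*(t), q*(t)), with initial angle ϑ(0) = ϑ₀ and limit lim_{t→∞} q*(t) = q∞. Equivalently, writing p* + i q* = r e^{iϑ} (so r(t) = 2q∞/sin(2ϑ(t))), one has ϑ̇ = −m/(2r²) and ṙ/r = −2·cot(2ϑ)·ϑ̇ on [0,∞). -/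

import Mathlib

open MeasureTheory Metric Real Filter Topology Set

noncomputable section

/-- `arccot`, with values in `(0, π)`. -/
def arccotR (x : ℝ) : ℝ := π / 2 - Real.arctan x

/-- The explicit angle `ϑ(t) = (1/2)·arccot(cot(2ϑ₀) + m t/(4q∞²))`. -/
def thetaF (m qinf ϑ₀ t : ℝ) : ℝ :=
  (1 / 2) * arccotR (Real.cot (2 * ϑ₀) + m * t / (4 * qinf ^ 2))

/-- `p*(t) = q∞ / sin ϑ(t)`. -/
def pstarF (m qinf ϑ₀ t : ℝ) : ℝ := qinf / Real.sin (thetaF m qinf ϑ₀ t)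

/-- `q*(t) = q∞ / cos ϑ(t)`. -/
def qstarF (m qinf ϑ₀ t : ℝ) : ℝ := qinf / Real.cos (thetaF m qinf ϑ₀ t)

/-- `r(t) = 2q∞ / sin(2ϑ(t))`, so that `p* + i q* = r e^{iϑ}`. -/
def rstarF (m qinf ϑ₀ t : ℝ) : ℝ := 2 * qinf / Real.sin (2 * thetaF m qinf ϑ₀ t)

/-- The point-vortex nonlinearity `F(x,y) = (m/2)(1/x − x/(x²+y²))`. -/
def Fpv (m x y : ℝ) : ℝ := (m / 2) * (1 / x - x / (x ^ 2 + y ^ 2))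

theorem thetaF_mem_Ioo (m qinf ϑ₀ t : ℝ) : thetaF m qinf ϑ₀ t ∈ Ioo (0 : ℝ) (π / 2) := by
  have h₁ := Real.arctan_lt_pi_div_two (Real.cot (2 * ϑ₀) + m * t / (4 * qinf ^ 2))
  have h₂ := Real.neg_pi_div_two_lt_arctan (Real.cot (2 * ϑ₀) + m * t / (4 * qinf ^ 2))
  constructor <;> unfold thetaF arccotR <;> linarith

theorem sin_thetaF_pos (m qinf ϑ₀ t : ℝ) : 0 < Real.sin (thetaF m qinf ϑ₀ t) := by
  obtain ⟨h₁, h₂⟩ := thetaF_mem_Ioo m qinf ϑ₀ t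
  exact Real.sin_pos_of_pos_of_lt_pi h₁ (by linarith)

theorem cos_thetaF_pos (m qinf ϑ₀ t : ℝ) : 0 < Real.cos (thetaF m qinf ϑ₀ t) := by
  obtain ⟨h₁, h₂⟩ := thetaF_mem_Ioo m qinf ϑ₀ t
  exact Real.cos_pos_of_mem_Ioo ⟨by linarith, h₂⟩

theorem sin_two_mul_thetaF_sq (m qinf ϑ₀ t : ℝ) :
    Real.sin (2 * thetaF m qinf ϑ₀ t) ^ 2 =
      1 / (1 + (Real.cot (2 * ϑ₀) + m * t / (4 * qinf ^ 2)) ^ 2) := by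
  rw [← Real.cos_sq_arctan, ← Real.sin_pi_div_two_sub]
  congr 2
  unfold thetaF arccotR
  ring

theorem thetaF_zero {m qinf ϑ₀ : ℝ} (hϑ : ϑ₀ ∈ Ioo (0 : ℝ) (π / 2)) :
    thetaF m qinf ϑ₀ 0 = ϑ₀ := by
  have hcot : Real.cot (2 * ϑ₀) = Real.tan (π / 2 - 2 * ϑ₀) := by
    rw [Real.tan_pi_div_two_sub, Real.cot_eq_cos_div_sin, Real.tan_eq_sin_div_cos, inv_div]
  have harc : Real.arctan (Real.cot (2 * ϑ₀)) = π / 2 - 2 * ϑ₀ := by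
    rw [hcot]
    exact Real.arctan_tan (by linarith [hϑ.2]) (by linarith [hϑ.1])
  simp only [thetaF, arccotR, mul_zero, zero_div, add_zero, harc]
  ring

theorem tendsto_thetaF_atTop {m qinf : ℝ} (ϑ₀ : ℝ) (hm : 0 < m) (hq : 0 < qinf) :
    Tendsto (thetaF m qinf ϑ₀) atTop (𝓝 0) := by
  have hlin : Tendsto (fun t => Real.cot (2 * ϑ₀) + m * t / (4 * qinf ^ 2)) atTop atTop :=
    tendsto_atTop_add_const_left _ _
      ((tendsto_id.const_mul_atTop hm).atTop_div_const (by positivity))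
  have harc := (Real.tendsto_arctan_atTop.mono_right nhdsWithin_le_nhds).comp hlin
  have hθ := (harc.const_sub (π / 2)).const_mul (1 / 2 : ℝ)
  rwa [sub_self, mul_zero] at hθ

theorem tendsto_qstarF_atTop {m qinf : ℝ} (ϑ₀ : ℝ) (hm : 0 < m) (hq : 0 < qinf) :
    Tendsto (qstarF m qinf ϑ₀) atTop (𝓝 qinf) := by
  have hcos := (Real.continuous_cos.tendsto 0).comp (tendsto_thetaF_atTop ϑ₀ hm hq)
  rw [Real.cos_zero] at hcos
  have hdiv := (tendsto_const_nhds (x := qinf)).div hcos one_ne_zero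
  rwa [div_one] at hdiv

theorem hasDerivAt_thetaF (m qinf ϑ₀ t : ℝ) :
    HasDerivAt (thetaF m qinf ϑ₀) (-(m / (2 * rstarF m qinf ϑ₀ t ^ 2))) t := by
  have hlin : HasDerivAt (fun t => Real.cot (2 * ϑ₀) + m * t / (4 * qinf ^ 2))
      (m * 1 / (4 * qinf ^ 2)) t :=
    (((hasDerivAt_id t).const_mul m).div_const _).const_add _
  refine ((hlin.arctan.const_sub (π / 2)).const_mul (1 / 2 : ℝ)).congr_deriv ?_
  rw [← sin_two_mul_thetaF_sq, rstarF, div_pow, div_eq_mul_inv m (2 * _), mul_inv, inv_div]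
  ring

theorem hasDerivAt_pstarF {qinf : ℝ} (m ϑ₀ t : ℝ) (hq : 0 < qinf) :
    HasDerivAt (pstarF m qinf ϑ₀) (Fpv m (qstarF m qinf ϑ₀ t) (pstarF m qinf ϑ₀ t)) t := by
  have hs := sin_thetaF_pos m qinf ϑ₀ t
  have hc := cos_thetaF_pos m qinf ϑ₀ t
  have hsc := Real.sin_sq_add_cos_sq (thetaF m qinf ϑ₀ t)
  refine ((hasDerivAt_const t qinf).div (hasDerivAt_thetaF m qinf ϑ₀ t).sin hs.ne').congr_deriv ?_
  simp only [Fpv, pstarF, qstarF, rstarF, Real.sin_two_mul]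
  generalize Real.sin (thetaF m qinf ϑ₀ t) = s at *
  generalize Real.cos (thetaF m qinf ϑ₀ t) = c at *
  have hsum : (qinf / c) ^ 2 + (qinf / s) ^ 2 = qinf ^ 2 / (s ^ 2 * c ^ 2) := by
    field_simp
    linear_combination hsc
  rw [hsum]
  field_simp
  linear_combination s * c * m * hsc

theorem hasDerivAt_qstarF {qinf : ℝ} (m ϑ₀ t : ℝ) (hq : 0 < qinf) :
    HasDerivAt (qstarF m qinf ϑ₀) (-Fpv m (pstarF m qinf ϑ₀ t) (qstarF m qinf ϑ₀ t)) t := by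
  have hs := sin_thetaF_pos m qinf ϑ₀ t
  have hc := cos_thetaF_pos m qinf ϑ₀ t
  have hsc := Real.sin_sq_add_cos_sq (thetaF m qinf ϑ₀ t)
  refine ((hasDerivAt_const t qinf).div (hasDerivAt_thetaF m qinf ϑ₀ t).cos hc.ne').congr_deriv ?_
  simp only [Fpv, pstarF, qstarF, rstarF, Real.sin_two_mul]
  generalize Real.sin (thetaF m qinf ϑ₀ t) = s at *
  generalize Real.cos (thetaF m qinf ϑ₀ t) = c at *
  have hsum : (qinf / s) ^ 2 + (qinf / c) ^ 2 = qinf ^ 2 / (s ^ 2 * c ^ 2) := by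
    field_simp
    linear_combination hsc
  rw [hsum]
  field_simp
  linear_combination -(s * c * m) * hsc

theorem deriv_rstarF_div_rstarF {qinf : ℝ} (m ϑ₀ t : ℝ) (hq : 0 < qinf) :
    deriv (rstarF m qinf ϑ₀) t / rstarF m qinf ϑ₀ t
      = -2 * Real.cot (2 * thetaF m qinf ϑ₀ t) * deriv (thetaF m qinf ϑ₀) t := by
  have hs : Real.sin (2 * thetaF m qinf ϑ₀ t) ≠ 0 := by
    rw [Real.sin_two_mul]
    have := sin_thetaF_pos m qinf ϑ₀ t
    have := cos_thetaF_pos m qinf ϑ₀ t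
    positivity
  have hθ := (hasDerivAt_thetaF m qinf ϑ₀ t).differentiableAt.hasDerivAt
  have hr : HasDerivAt (rstarF m qinf ϑ₀) _ t :=
    (hasDerivAt_const t (2 * qinf)).div (hθ.const_mul 2).sin hs
  rw [hr.deriv, rstarF, Real.cot_eq_cos_div_sin]
  field_simp
  ring

/-- the explicit functions `ϑ, p*, q*` solve the symmetric two-pair
point-vortex system `ṗ* = F(q*,p*)`, `q̇* = −F(p*,q*)` on `[0,∞)`, with `ϑ(0) = ϑ₀` and
`q*(t) → q∞`; equivalently, in polar form `p* + i q* = r e^{iϑ}` one has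
`ϑ̇ = −m/(2r²)` and `ṙ/r = −2 cot(2ϑ) ϑ̇`. -/
theorem statement_6 (m qinf ϑ₀ : ℝ) (hm : 0 < m) (hq : 0 < qinf)
    (hϑ : ϑ₀ ∈ Ioo (0:ℝ) (π / 2)) :
    thetaF m qinf ϑ₀ 0 = ϑ₀ ∧
    Tendsto (qstarF m qinf ϑ₀) atTop (𝓝 qinf) ∧
    ∀ t : ℝ, 0 ≤ t →
      HasDerivAt (pstarF m qinf ϑ₀) (Fpv m (qstarF m qinf ϑ₀ t) (pstarF m qinf ϑ₀ t)) t ∧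
      HasDerivAt (qstarF m qinf ϑ₀) (-Fpv m (pstarF m qinf ϑ₀ t) (qstarF m qinf ϑ₀ t)) t ∧
      HasDerivAt (thetaF m qinf ϑ₀) (-(m / (2 * rstarF m qinf ϑ₀ t ^ 2))) t ∧
      deriv (rstarF m qinf ϑ₀) t / rstarF m qinf ϑ₀ t
        = -2 * Real.cot (2 * thetaF m qinf ϑ₀ t) * deriv (thetaF m qinf ϑ₀) t := by
  exact ⟨thetaF_zero hϑ, tendsto_qstarF_atTop ϑ₀ hm hq, fun t _ =>
    ⟨hasDerivAt_pstarF m ϑ₀ t hq, hasDerivAt_qstarF m ϑ₀ t hq, hasDerivAt_thetaF m qinf ϑ₀ t,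
      deriv_rstarF_div_rstarF m ϑ₀ t hq⟩⟩
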